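/- Define F : ℂ⁴ → ℂ⁴ by F(s,v,t,u) = (s²t, s²u, t(v² + isv), u(v² − ivs)) and the quartic polynomial K(Z₀,Z₁,Z₂,Z₃) = (Z₁Z₂ − Z₀Z₃)² + 2Z₀Z₁(Z₁Z₂ + Z₀Z₃). Then: (a) K(F(s,v,t,u)) = 0 for all s,v,t,u ∈ ℂ; and (b) for every nonzero (Z₀,Z₁,Z₂,Z₃) ∈ ℂ⁴ with K(Z₀,Z₁,Z₂,Z₃) = 0 there exist (s,v) ∈ ℂ² ∖ {(0,0)}, (t,u) ∈ ℂ² ∖ {(0,0)} and λ ∈ ℂ ∖ {0} such that F(s,v,t,u) = λ·(Z₀,Z₁,Z₂,Z₃). In other words, the map F induces a surjection from ℂP¹ × ℂP¹ onto the quartic surface 𝒦 = {[Z] ∈ ℂP³ : K(Z) = 0}. -/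

import Mathlib

open Complex

/-- The quartic polynomial `K(Z₀,Z₁,Z₂,Z₃) = (Z₁Z₂ - Z₀Z₃)² + 2Z₀Z₁(Z₁Z₂ + Z₀Z₃)`. -/
def quarticK (Z₀ Z₁ Z₂ Z₃ : ℂ) : ℂ :=
  (Z₁ * Z₂ - Z₀ * Z₃) ^ 2 + 2 * Z₀ * Z₁ * (Z₁ * Z₂ + Z₀ * Z₃)

/-- The homogeneous twistor lift `F(s,v,t,u) = (s²t, s²u, t(v²+isv), u(v²-ivs))`. -/
def twistorLiftF (s v t u : ℂ) : ℂ × ℂ × ℂ × ℂ :=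
  (s ^ 2 * t, s ^ 2 * u, t * (v ^ 2 + I * s * v), u * (v ^ 2 - I * v * s))

/-- Every monic quadratic equation over `ℂ` has a solution. -/
theorem exists_sq_add_mul_eq (c a : ℂ) : ∃ v : ℂ, v ^ 2 + c * v = a := by
  obtain ⟨w, hw⟩ := IsAlgClosed.exists_pow_nat_eq (c ^ 2 + 4 * a) two_pos
  exact ⟨(w - c) / 2, by linear_combination hw / 4⟩

/-- (a) The image of `F` lies in the zero locus of `K`; (b) every nonzero
zero of `K` is, up to a nonzero scalar, in the image of `F` with `(s,v) ≠ (0,0)` and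
`(t,u) ≠ (0,0)`: `F` induces a surjection of `ℂP¹ × ℂP¹` onto the quartic surface `𝒦`. -/
theorem statement15 :
    (∀ s v t u : ℂ,
      quarticK (s ^ 2 * t) (s ^ 2 * u) (t * (v ^ 2 + I * s * v)) (u * (v ^ 2 - I * v * s))
        = 0) ∧
    (∀ Z₀ Z₁ Z₂ Z₃ : ℂ, (Z₀, Z₁, Z₂, Z₃) ≠ (0, 0, 0, 0) → quarticK Z₀ Z₁ Z₂ Z₃ = 0 →
      ∃ s v t u lam : ℂ, (s, v) ≠ (0, 0) ∧ (t, u) ≠ (0, 0) ∧ lam ≠ 0 ∧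
        twistorLiftF s v t u = (lam * Z₀, lam * Z₁, lam * Z₂, lam * Z₃)) := by
  refine ⟨fun s v t u => ?_, fun Z₀ Z₁ Z₂ Z₃ hZ hK => ?_⟩
  · unfold quarticK
    linear_combination (4 * s ^ 6 * t ^ 2 * u ^ 2 * v ^ 2) * I_sq
  unfold quarticK at hK
  by_cases h₀ : Z₀ = 0
  · subst h₀
    by_cases h₁ : Z₁ = 0
    · subst h₁
      refine ⟨0, 1, Z₂, Z₃, 1, by simp, fun h => hZ ?_, one_ne_zero, by simp [twistorLiftF]⟩
      simpa using h
    · have h₂ : Z₂ = 0 := by simpa [h₁] using hK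
      obtain ⟨v, hv⟩ := exists_sq_add_mul_eq (-I) (Z₃ / Z₁)
      rw [eq_div_iff h₁] at hv
      refine ⟨1, v, 0, Z₁, 1, by simp, by simp [h₁], one_ne_zero, ?_⟩
      simp only [twistorLiftF, Prod.mk.injEq]
      exact ⟨by ring, by ring, by simp [h₂], by linear_combination hv⟩
  by_cases h₁ : Z₁ = 0
  · subst h₁
    have h₃ : Z₃ = 0 := by simpa [h₀] using hK
    obtain ⟨v, hv⟩ := exists_sq_add_mul_eq I (Z₂ / Z₀)
    rw [eq_div_iff h₀] at hv
    refine ⟨1, v, Z₀, 0, 1, by simp, by simp [h₀], one_ne_zero, ?_⟩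
    simp only [twistorLiftF, Prod.mk.injEq]
    exact ⟨by ring, by ring, by linear_combination hv, by simp [h₃]⟩
  obtain ⟨a, rfl⟩ : ∃ a, Z₂ = Z₀ * a := ⟨Z₂ / Z₀, by field_simp⟩
  obtain ⟨b, rfl⟩ : ∃ b, Z₃ = Z₁ * b := ⟨Z₃ / Z₁, by field_simp⟩
  have hab : (a - b) ^ 2 + 2 * (a + b) = 0 := by
    refine (mul_eq_zero.mp ?_).resolve_left (pow_ne_zero 2 (mul_ne_zero h₀ h₁))
    linear_combination hK
  refine ⟨1, -I * (a - b) / 2, Z₀, Z₁, 1, by simp, by simp [h₀], one_ne_zero, ?_⟩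
  simp only [twistorLiftF, Prod.mk.injEq]
  refine ⟨by ring, by ring, ?_, ?_⟩
  · linear_combination (Z₀ * ((a - b) ^ 2 / 4 - (a - b) / 2)) * I_sq - Z₀ / 4 * hab
  · linear_combination (Z₁ * ((a - b) ^ 2 / 4 + (a - b) / 2)) * I_sq - Z₁ / 4 * hab
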